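/- arXiv:2412.01932 — 3 statements merged into one kernel-verified Lean document; each statement's English description precedes it below -/
import Mathlib

section
/- Let N ≥ 3 be an integer and let a_{N−2}, a_{N−1}, a_N be real numbers satisfying the hyperbolicity constraint √((N−1)/2)·a_{N−1} + a_N·a_{N−2} − √(N/2)·a_{N−2}² > 0. Then there exist real numbers b₁, b₂, b₃ such that the 2×2 matrix B = [[b₁, b₂], [b₂, b₃]] is symmetric positive definite and the (N+1)×(N+1) block-diagonal matrix A₀ = diag(I_{N−1}, B) (where I_{N−1} is the (N−1)×(N−1) identity matrix), which is itself symmetric positive definite, satisfies that the product A₀·A is a symmetric matrix. -/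
/-- The `(N+1) × (N+1)` coefficient matrix `A` of the moment closure system:
`A_{k,k+1} = √((k+1)/2)` for `0 ≤ k ≤ N-1`, `A_{k,k-1} = √(k/2)` for `1 ≤ k ≤ N-1`,
last row has `a_{N-2}, a_{N-1}, a_N` in columns `N-2, N-1, N`, all other entries `0`. -/
noncomputable def closureMatrix (N : ℕ) (aN2 aN1 aN : ℝ) :
    Matrix (Fin (N + 1)) (Fin (N + 1)) ℝ :=
  Matrix.of fun i j =>
    if i.val < N then
      if j.val = i.val + 1 then Real.sqrt (((i.val : ℝ) + 1) / 2)
      else if 1 ≤ i.val ∧ j.val + 1 = i.val then Real.sqrt ((i.val : ℝ) / 2)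
      else 0
    else
      if j.val + 2 = N then aN2
      else if j.val + 1 = N then aN1
      else if j.val = N then aN
      else 0

/-- The `(N+1) × (N+1)` block-diagonal matrix `A₀ = diag(I_{N-1}, B)` where
`B = [[b₁, b₂], [b₂, b₃]]` occupies the rows/columns indexed `N-1, N`. -/
noncomputable def blockSymmetrizer (N : ℕ) (b1 b2 b3 : ℝ) :
    Matrix (Fin (N + 1)) (Fin (N + 1)) ℝ :=
  Matrix.of fun i j =>
    if i.val + 1 < N then (if i = j then (1 : ℝ) else 0)
    else if j.val + 1 < N then 0
    else if i.val + 1 = N then (if j.val + 1 = N then b1 else b2)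
    else (if j.val + 1 = N then b2 else b3)

open scoped Matrix

/-- Left multiplication by `blockSymmetrizer`, one entry at a time. -/
theorem sum_blockSymmetrizer_mul (M : ℕ) (b1 b2 b3 : ℝ) (f : Fin (M + 1 + 1) → ℝ)
    (i : Fin (M + 1 + 1)) :
    ∑ k, blockSymmetrizer (M + 1) b1 b2 b3 i k * f k =
      if i.val < M then f i
      else if i.val = M then b1 * f (Fin.last M).castSucc + b2 * f (Fin.last (M + 1))
      else b2 * f (Fin.last M).castSucc + b3 * f (Fin.last (M + 1)) := by
  by_cases hi : i.val < M
  · simp [blockSymmetrizer, hi]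
  · have hz : ∑ k : Fin M, blockSymmetrizer (M + 1) b1 b2 b3 i k.castSucc.castSucc *
        f k.castSucc.castSucc = 0 :=
      Finset.sum_eq_zero fun k _ => by simp [blockSymmetrizer, hi]
    rw [Fin.sum_univ_castSucc, Fin.sum_univ_castSucc, hz]
    by_cases hM : i.val = M <;> simp [blockSymmetrizer, hi, hM]

theorem blockSymmetrizer_isSymm (N : ℕ) (b1 b2 b3 : ℝ) :
    (blockSymmetrizer N b1 b2 b3).IsSymm := by
  ext i j
  simp only [blockSymmetrizer, Matrix.transpose_apply, Matrix.of_apply, Fin.ext_iff]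
  split_ifs <;> first | rfl | omega

theorem posDef_fin_two_of_completed_square {b c : ℝ} (hb : 0 < b) :
    (!![1 + b * c ^ 2, -(b * c); -(b * c), b] : Matrix (Fin 2) (Fin 2) ℝ).PosDef := by
  refine Matrix.PosDef.of_dotProduct_mulVec_pos ?_ fun x hx => ?_
  · ext i j
    fin_cases i <;> fin_cases j <;> simp
  · have key : star x ⬝ᵥ (!![1 + b * c ^ 2, -(b * c); -(b * c), b] *ᵥ x) =
        x 0 ^ 2 + b * (x 1 - c * x 0) ^ 2 := by
      simp [dotProduct, Matrix.mulVec, Fin.sum_univ_two]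
      ring
    rw [key]
    by_cases h0 : x 0 = 0
    · have h1 : x 1 ≠ 0 := fun h1 => hx (by ext i; fin_cases i <;> simp [h0, h1])
      rw [h0]
      simp only [mul_zero, sub_zero]
      positivity
    · positivity

theorem blockSymmetrizer_posDef (M : ℕ) {b c : ℝ} (hb : 0 < b) :
    (blockSymmetrizer (M + 1) (1 + b * c ^ 2) (-(b * c)) b).PosDef := by
  refine Matrix.PosDef.of_dotProduct_mulVec_pos ?_ fun x hx => ?_
  · rw [Matrix.IsHermitian, Matrix.conjTranspose_eq_transpose_of_trivial]
    exact blockSymmetrizer_isSymm _ _ _ _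
  · have key : star x ⬝ᵥ (blockSymmetrizer (M + 1) (1 + b * c ^ 2) (-(b * c)) b *ᵥ x) =
        ∑ i : Fin (M + 1), x i.castSucc ^ 2 +
          b * (x (Fin.last (M + 1)) - c * x (Fin.last M).castSucc) ^ 2 := by
      simp only [dotProduct, Matrix.mulVec, sum_blockSymmetrizer_mul, star_trivial]
      rw [Fin.sum_univ_castSucc, Fin.sum_univ_castSucc, Fin.sum_univ_castSucc]
      simp
      simp only [← pow_two]
      ring
    rw [key]
    have hs : 0 ≤ ∑ i : Fin (M + 1), x i.castSucc ^ 2 :=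
      Finset.sum_nonneg fun i _ => sq_nonneg _
    by_cases h0 : ∀ i : Fin (M + 1), x i.castSucc = 0
    · have h1 : x (Fin.last (M + 1)) ≠ 0 := fun h1 =>
        hx (by ext i; exact Fin.lastCases h1 h0 i)
      rw [h0 (Fin.last M)]
      simp only [mul_zero, sub_zero]
      positivity
    · push Not at h0
      obtain ⟨i, hi⟩ := h0
      have : 0 < ∑ i : Fin (M + 1), x i.castSucc ^ 2 :=
        Finset.sum_pos' (fun i _ => sq_nonneg _) ⟨i, Finset.mem_univ _, by positivity⟩
      positivity

theorem blockSymmetrizer_mul_closureMatrix_isSymm (M : ℕ) (b1 b2 b3 aN2 aN1 aN : ℝ)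
    (h1 : b1 * √((M : ℝ) / 2) + b2 * aN2 = √((M : ℝ) / 2))
    (h2 : b2 * √((M : ℝ) / 2) + b3 * aN2 = 0)
    (h3 : b3 * aN1 = b1 * √(((M : ℝ) + 1) / 2) + b2 * aN) :
    (blockSymmetrizer (M + 1) b1 b2 b3 * closureMatrix (M + 1) aN2 aN1 aN).IsSymm := by
  refine Matrix.IsSymm.ext_iff.2 ?_
  have key : ∀ i j : Fin (M + 1 + 1), i.val < j.val →
      (blockSymmetrizer (M + 1) b1 b2 b3 * closureMatrix (M + 1) aN2 aN1 aN) j i =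
      (blockSymmetrizer (M + 1) b1 b2 b3 * closureMatrix (M + 1) aN2 aN1 aN) i j := by
    rintro ⟨i, hi⟩ ⟨j, hj⟩ hij
    simp only at hij
    simp only [Matrix.mul_apply, sum_blockSymmetrizer_mul]
    simp only [closureMatrix, Matrix.of_apply, Fin.val_castSucc, Fin.val_last]
    rcases Nat.lt_trichotomy j M with hjM | rfl | hjM
    · have : i < M := by omega
      by_cases hji : j = i + 1
      · subst hji
        simp [this, hjM, show i < M + 1 by omega, show i ≠ i + 1 + 1 by omega]
      · simp [this, hjM, hji, show i < M + 1 by omega, show j < M + 1 by omega,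
          show i ≠ j + 1 by omega, show j + 1 ≠ i by omega, Ne.symm hji]
    · by_cases hji : j = i + 1
      · subst hji
        simpa [show i < i + 1 + 1 by omega, show i ≠ i + 1 + 1 by omega] using h1
      · simp [hij, hji, show i < j + 1 by omega, Ne.symm hji, show i ≠ j + 1 by omega,
          show i ≠ j by omega, show j + 1 ≠ i by omega]
    · obtain rfl : j = M + 1 := by omega
      rcases Nat.lt_trichotomy (i + 1) M with hiM | rfl | hiM
      · simp [show i < M by omega, show i < M + 1 by omega, show i ≠ M by omega,
          show i ≠ M + 1 by omega, show i + 1 ≠ M by omega, show M ≠ i by omega,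
          show M + 1 + 1 ≠ i by omega]
      · simpa [show i < i + 1 + 1 by omega, show i ≠ i + 1 + 1 by omega,
          show i + 1 + 1 + 1 ≠ i by omega] using h2
      · obtain rfl : i = M := by omega
        simpa using h3
  intro i j
  rcases Nat.lt_trichotomy i.val j.val with h | h | h
  · exact key i j h
  · rw [Fin.ext h]
  · exact (key j i h).symm


theorem stmt_0 (N : ℕ) (hN : 3 ≤ N) (aN2 aN1 aN : ℝ)
    (hyp : Real.sqrt (((N : ℝ) - 1) / 2) * aN1 + aN * aN2
        - Real.sqrt ((N : ℝ) / 2) * aN2 ^ 2 > 0) :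
    ∃ b1 b2 b3 : ℝ,
      (!![b1, b2; b2, b3] : Matrix (Fin 2) (Fin 2) ℝ).PosDef ∧
      (blockSymmetrizer N b1 b2 b3).PosDef ∧
      (blockSymmetrizer N b1 b2 b3 * closureMatrix N aN2 aN1 aN).IsSymm := by
  obtain ⟨M, rfl⟩ : ∃ M, N = M + 1 := ⟨N - 1, by omega⟩
  have hM : (2 : ℝ) ≤ M := by exact_mod_cast (by omega : 2 ≤ M)
  push_cast at hyp
  rw [add_sub_cancel_right] at hyp
  set s := √((M : ℝ) / 2) with hs
  set t := √(((M : ℝ) + 1) / 2) with ht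
  have hs1 : 1 ≤ s := Real.one_le_sqrt.2 (by linarith)
  have hs0 : 0 < s := by linarith
  have ht0 : 0 < t := Real.sqrt_pos.2 (by linarith)
  have hD : 0 < s ^ 2 * aN1 + s * aN * aN2 - t * aN2 ^ 2 := by
    have e1 := mul_pos hs0 hyp
    have e2 : 0 ≤ (s - 1) * (t * aN2 ^ 2) :=
      mul_nonneg (by linarith) (by positivity)
    nlinarith
  set D := s ^ 2 * aN1 + s * aN * aN2 - t * aN2 ^ 2 with hDdef
  have hb : 0 < s ^ 2 * t / D := by positivity
  refine ⟨1 + s ^ 2 * t / D * (aN2 / s) ^ 2, -(s ^ 2 * t / D * (aN2 / s)), s ^ 2 * t / D,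
    posDef_fin_two_of_completed_square hb, blockSymmetrizer_posDef M hb,
    blockSymmetrizer_mul_closureMatrix_isSymm M _ _ _ _ _ _ ?_ ?_ ?_⟩
  · rw [← hs]
    field_simp
    ring
  · rw [← hs]
    field_simp
    ring
  · rw [← ht]
    field_simp
    rw [hDdef]
    ring
end

section
/- Let N ≥ 3 be an integer and a_{N−2}, a_{N−1}, a_N real numbers satisfying the hyperbolicity constraint √((N−1)/2)·a_{N−1} + a_N·a_{N−2} − √(N/2)·a_{N−2}² > 0. With D := ((N−1)/2)·a_{N−1} + √((N−1)/2)·a_{N−2}·a_N − √(N/2)·a_{N−2}², define b₁ := √((N−1)/2)·(√((N−1)/2)·a_{N−1} + a_N·a_{N−2})/D, b₂ := −√((N−1)/2)·√(N/2)·a_{N−2}/D, b₃ := √((N−1)/2)·√(N/2)/D. Then the 2×2 matrix B = [[b₁, b₂], [b₂, b₃]] is symmetric positive definite. -/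
open scoped Matrix in
/-- A symmetric real `2 × 2` matrix with positive lower-right entry and positive determinant
is positive definite. -/
theorem Matrix.posDef_fin_two_of_pos {a b c : ℝ} (hc : 0 < c) (hdet : 0 < a * c - b ^ 2) :
    (!![a, b; b, c] : Matrix (Fin 2) (Fin 2) ℝ).PosDef := by
  refine Matrix.PosDef.of_dotProduct_mulVec_pos ?_ fun x hx => ?_
  · ext i j
    fin_cases i <;> fin_cases j <;> simp
  · have hform : 0 < c * (a * x 0 ^ 2 + 2 * b * x 0 * x 1 + c * x 1 ^ 2) := by
      have hsq : c * (a * x 0 ^ 2 + 2 * b * x 0 * x 1 + c * x 1 ^ 2)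
          = (c * x 1 + b * x 0) ^ 2 + (a * c - b ^ 2) * x 0 ^ 2 := by ring
      by_cases h0 : x 0 = 0
      · have h1 : x 1 ≠ 0 := by
          intro h1
          apply hx
          ext i
          fin_cases i
          · exact h0
          · exact h1
        rw [hsq, h0]
        have : 0 < (c * x 1) ^ 2 := by positivity
        simpa using this
      · rw [hsq]
        positivity
    have hpos := pos_of_mul_pos_right hform hc.le
    have hquad : star x ⬝ᵥ !![a, b; b, c] *ᵥ x
        = a * x 0 ^ 2 + 2 * b * x 0 * x 1 + c * x 1 ^ 2 := by
      simp [Matrix.mulVec, dotProduct, Fin.sum_univ_two]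
      ring
    rwa [hquad]

theorem stmt_5 (N : ℕ) (hN : 3 ≤ N) (aN2 aN1 aN : ℝ) (D b1 b2 b3 : ℝ)
    (hyp : Real.sqrt (((N : ℝ) - 1) / 2) * aN1 + aN * aN2
        - Real.sqrt ((N : ℝ) / 2) * aN2 ^ 2 > 0)
    (hD : D = (((N : ℝ) - 1) / 2) * aN1 + Real.sqrt (((N : ℝ) - 1) / 2) * aN2 * aN
        - Real.sqrt ((N : ℝ) / 2) * aN2 ^ 2)
    (hb1 : b1 = Real.sqrt (((N : ℝ) - 1) / 2)
        * (Real.sqrt (((N : ℝ) - 1) / 2) * aN1 + aN * aN2) / D)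
    (hb2 : b2 = -(Real.sqrt (((N : ℝ) - 1) / 2) * Real.sqrt ((N : ℝ) / 2) * aN2) / D)
    (hb3 : b3 = Real.sqrt (((N : ℝ) - 1) / 2) * Real.sqrt ((N : ℝ) / 2) / D) :
    (!![b1, b2; b2, b3] : Matrix (Fin 2) (Fin 2) ℝ).PosDef := by
  have hN' : (3 : ℝ) ≤ N := by exact_mod_cast hN
  have hs : 1 ≤ √(((N : ℝ) - 1) / 2) := Real.one_le_sqrt.2 (by linarith)
  have hss : √(((N : ℝ) - 1) / 2) ^ 2 = ((N : ℝ) - 1) / 2 := Real.sq_sqrt (by linarith)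
  have ht : 0 < √((N : ℝ) / 2) := Real.sqrt_pos.2 (by linarith)
  generalize √(((N : ℝ) - 1) / 2) = s at *
  generalize √((N : ℝ) / 2) = t at *
  have hs0 : 0 < s := by linarith
  have hP : 0 < s * aN1 + aN * aN2 := by
    have : 0 ≤ t * aN2 ^ 2 := by positivity
    linarith
  have hDpos : 0 < D := by
    have := le_mul_of_one_le_left hP.le hs
    rw [hD, ← hss]
    linarith
  refine Matrix.posDef_fin_two_of_pos (by rw [hb3]; positivity) ?_
  have hdet : b1 * b3 - b2 ^ 2
      = s ^ 2 * t * (s * aN1 + aN * aN2 - t * aN2 ^ 2) / D ^ 2 := by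
    rw [hb1, hb2, hb3]
    field_simp
  rw [hdet]
  positivity
end

section
/- Let N ≥ 3 be an integer, a_{N−2}, a_{N−1}, a_N real numbers, and b₁, b₂, b₃ real numbers. Let B = [[b₁, b₂], [b₂, b₃]] and let A₀ = diag(I_{N−1}, B) be the (N+1)×(N+1) block-diagonal matrix whose upper-left block is the (N−1)×(N−1) identity matrix. Then the product A₀·A is a symmetric matrix if and only if the following three equations hold: √((N−1)/2)·b₁ + a_{N−2}·b₂ = √((N−1)/2); √((N−1)/2)·b₂ + a_{N−2}·b₃ = 0; √(N/2)·b₁ + a_N·b₂ = a_{N−1}·b₃. -/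
theorem closureMatrix_apply_succ {N : ℕ} (aN2 aN1 aN : ℝ) {i j : Fin (N + 1)}
    (h : j.val = i.val + 1) :
    closureMatrix N aN2 aN1 aN i j = Real.sqrt (((i.val : ℝ) + 1) / 2) := by
  have hi : i.val < N := by omega
  simp only [closureMatrix, Matrix.of_apply, if_pos hi, if_pos h]

theorem closureMatrix_apply_pred {N : ℕ} (aN2 aN1 aN : ℝ) {i j : Fin (N + 1)}
    (hi : i.val < N) (h : i.val = j.val + 1) :
    closureMatrix N aN2 aN1 aN i j = Real.sqrt (((j.val : ℝ) + 1) / 2) := by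
  have hj : j.val ≠ i.val + 1 := by omega
  have hij : 1 ≤ i.val ∧ j.val + 1 = i.val := by omega
  simp only [closureMatrix, Matrix.of_apply, if_pos hi, if_neg hj, if_pos hij]
  simp only [h, Nat.cast_add, Nat.cast_one]

theorem closureMatrix_apply_eq_zero {N : ℕ} (aN2 aN1 aN : ℝ) {i j : Fin (N + 1)}
    (hi : i.val < N) (h : j.val ≠ i.val + 1) (h' : i.val ≠ j.val + 1) :
    closureMatrix N aN2 aN1 aN i j = 0 := by
  have hij : ¬(1 ≤ i.val ∧ j.val + 1 = i.val) := by omega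
  simp only [closureMatrix, Matrix.of_apply, if_pos hi, if_neg h, if_neg hij]

theorem closureMatrix_last_apply {N : ℕ} (aN2 aN1 aN : ℝ) (j : Fin (N + 1)) :
    closureMatrix N aN2 aN1 aN (Fin.last N) j =
      if j.val + 2 = N then aN2 else if j.val + 1 = N then aN1
      else if j.val = N then aN else 0 := by
  simp [closureMatrix]

theorem blockSymmetrizer_mul_apply_of_lt {N : ℕ} (b1 b2 b3 : ℝ)
    (M : Matrix (Fin (N + 1)) (Fin (N + 1)) ℝ) {i : Fin (N + 1)} (hi : i.val + 1 < N)
    (j : Fin (N + 1)) :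
    (blockSymmetrizer N b1 b2 b3 * M) i j = M i j := by
  simp [Matrix.mul_apply, blockSymmetrizer, hi]

theorem blockSymmetrizer_mul_apply_of_ge {n : ℕ} (b1 b2 b3 : ℝ)
    (M : Matrix (Fin (n + 1 + 1)) (Fin (n + 1 + 1)) ℝ) {i : Fin (n + 1 + 1)} (hi : n ≤ i.val)
    (j : Fin (n + 1 + 1)) :
    (blockSymmetrizer (n + 1) b1 b2 b3 * M) i j =
      (if i.val = n then b1 else b2) * M (Fin.last n).castSucc j +
        (if i.val = n then b2 else b3) * M (Fin.last (n + 1)) j := by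
  rw [Matrix.mul_apply, Fin.sum_univ_castSucc, Fin.sum_univ_castSucc]
  simp [blockSymmetrizer, not_lt.mpr hi]

theorem stmt_6 (N : ℕ) (hN : 3 ≤ N) (aN2 aN1 aN : ℝ) (b1 b2 b3 : ℝ) :
    (blockSymmetrizer N b1 b2 b3 * closureMatrix N aN2 aN1 aN).IsSymm ↔
      (Real.sqrt (((N : ℝ) - 1) / 2) * b1 + aN2 * b2 = Real.sqrt (((N : ℝ) - 1) / 2) ∧
       Real.sqrt (((N : ℝ) - 1) / 2) * b2 + aN2 * b3 = 0 ∧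
       Real.sqrt ((N : ℝ) / 2) * b1 + aN * b2 = aN1 * b3) := by
  obtain ⟨n, rfl⟩ : ∃ n, N = n + 1 + 1 := ⟨N - 2, by omega⟩
  have hcast : ((n + 1 + 1 : ℕ) : ℝ) - 1 = (n : ℝ) + 1 := by push_cast; ring
  rw [hcast, Matrix.IsSymm.ext_iff]
  set A := closureMatrix (n + 1 + 1) aN2 aN1 aN with hA
  set S := blockSymmetrizer (n + 1 + 1) b1 b2 b3 * A with hS
  have row_lt : ∀ i j : Fin (n + 1 + 1 + 1), i.val < n + 1 → S i j = A i j := fun i j hi =>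
    blockSymmetrizer_mul_apply_of_lt _ _ _ _ (by omega) j
  have row_ge : ∀ i j : Fin (n + 1 + 1 + 1), n + 1 ≤ i.val → S i j =
      (if i.val = n + 1 then b1 else b2) * A (Fin.last (n + 1)).castSucc j +
        (if i.val = n + 1 then b2 else b3) * A (Fin.last (n + 1 + 1)) j := fun i j hi =>
    blockSymmetrizer_mul_apply_of_ge _ _ _ _ hi j
  have penultimate_pred : ∀ j : Fin (n + 1 + 1 + 1), j.val = n →
      A (Fin.last (n + 1)).castSucc j = Real.sqrt (((n : ℝ) + 1) / 2) := fun j hj => by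
    rw [hA, closureMatrix_apply_pred _ _ _ (by simp) (by simp [hj]), hj]
  have penultimate_last : ∀ j : Fin (n + 1 + 1 + 1), j.val = n + 1 + 1 →
      A (Fin.last (n + 1)).castSucc j = Real.sqrt (((n + 1 + 1 : ℕ) : ℝ) / 2) := fun j hj => by
    rw [hA, closureMatrix_apply_succ _ _ _ (by simp [hj])]
    simp
  have penultimate_self : ∀ j : Fin (n + 1 + 1 + 1), j.val = n + 1 →
      A (Fin.last (n + 1)).castSucc j = 0 := fun j hj => by
    rw [hA, closureMatrix_apply_eq_zero _ _ _ (by simp) (by simp [hj]) (by simp [hj])]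
  have iff₁ : ∀ i j : Fin (n + 1 + 1 + 1), i.val = n → j.val = n + 1 →
      (S j i = S i j ↔ Real.sqrt (((n : ℝ) + 1) / 2) * b1 + aN2 * b2 =
        Real.sqrt (((n : ℝ) + 1) / 2)) := fun i j hi hj => by
    rw [row_ge j i (by omega), row_lt i j (by omega), penultimate_pred i hi, hA,
      closureMatrix_last_apply, closureMatrix_apply_succ _ _ _ (by omega), if_pos hj, if_pos hj,
      if_pos (by omega), hi, mul_comm b1, mul_comm b2]
  have iff₂ : ∀ i j : Fin (n + 1 + 1 + 1), i.val = n → j.val = n + 1 + 1 →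
      (S j i = S i j ↔ Real.sqrt (((n : ℝ) + 1) / 2) * b2 + aN2 * b3 = 0) := fun i j hi hj => by
    rw [row_ge j i (by omega), row_lt i j (by omega), penultimate_pred i hi, hA,
      closureMatrix_last_apply,
      closureMatrix_apply_eq_zero (i := i) _ _ _ (by omega) (by omega) (by omega),
      if_neg (by omega), if_neg (by omega), if_pos (by omega), mul_comm b2, mul_comm b3]
  have iff₃ : ∀ i j : Fin (n + 1 + 1 + 1), i.val = n + 1 → j.val = n + 1 + 1 →
      (S j i = S i j ↔ Real.sqrt (((n + 1 + 1 : ℕ) : ℝ) / 2) * b1 + aN * b2 = aN1 * b3) :=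
      fun i j hi hj => by
    rw [row_ge j i (by omega), row_ge i j (by omega), penultimate_self i hi,
      penultimate_last j hj, hA, closureMatrix_last_apply, closureMatrix_last_apply]
    simp only [hi, hj, Nat.add_right_cancel_iff, if_true, if_false, mul_zero, zero_add,
      show n + 1 + 1 + 2 ≠ n + 1 + 1 by omega, show n + 1 + 2 ≠ n + 1 + 1 by omega,
      show n + 1 + 1 ≠ n + 1 by omega]
    rw [eq_comm, mul_comm b1, mul_comm b2, mul_comm b3]
  have upper : ∀ i j : Fin (n + 1 + 1 + 1), i < j → (i.val < n ∨ j.val < n + 1) →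
      S j i = S i j := fun i j hij hn => by
    rw [Fin.lt_def] at hij
    rw [row_lt i j (by omega)]
    rcases lt_or_ge j.val (n + 1) with hj | hj
    · rw [row_lt j i hj]
      by_cases hs : j.val = i.val + 1
      · rw [hA, closureMatrix_apply_succ _ _ _ hs, closureMatrix_apply_pred _ _ _ (by omega) hs]
      · rw [hA, closureMatrix_apply_eq_zero _ _ _ (by omega) hs (by omega),
          closureMatrix_apply_eq_zero _ _ _ (by omega) (by omega) hs]
    · have hlast : (Fin.last (n + 1)).castSucc.val = n + 1 := rfl
      rw [row_ge j i hj, hA,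
        closureMatrix_apply_eq_zero (i := i) _ _ _ (by omega) (by omega) (by omega),
        closureMatrix_apply_eq_zero (i := (Fin.last (n + 1)).castSucc) _ _ _
          (by omega) (by omega) (by omega), closureMatrix_last_apply,
        if_neg (show ¬i.val + 2 = n + 1 + 1 by omega),
        if_neg (show ¬i.val + 1 = n + 1 + 1 by omega), if_neg (show ¬i.val = n + 1 + 1 by omega),
        mul_zero, mul_zero, add_zero]
  constructor
  · intro h
    exact ⟨(iff₁ (Fin.last n).castSucc.castSucc (Fin.last (n + 1)).castSucc rfl rfl).1 (h _ _),
      (iff₂ (Fin.last n).castSucc.castSucc (Fin.last (n + 1 + 1)) rfl rfl).1 (h _ _),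
      (iff₃ (Fin.last (n + 1)).castSucc (Fin.last (n + 1 + 1)) rfl rfl).1 (h _ _)⟩
  · rintro ⟨h₁, h₂, h₃⟩
    have key : ∀ i j : Fin (n + 1 + 1 + 1), i < j → S j i = S i j := fun i j hij => by
      have hval : i.val < j.val := hij
      rcases (by omega : (i.val < n ∨ j.val < n + 1) ∨ (i.val = n ∧ j.val = n + 1) ∨
        (i.val = n ∧ j.val = n + 1 + 1) ∨ (i.val = n + 1 ∧ j.val = n + 1 + 1)) with
        h | ⟨hi, hj⟩ | ⟨hi, hj⟩ | ⟨hi, hj⟩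
      · exact upper i j hij h
      · exact (iff₁ i j hi hj).2 h₁
      · exact (iff₂ i j hi hj).2 h₂
      · exact (iff₃ i j hi hj).2 h₃
    intro i j
    rcases lt_trichotomy i j with h | rfl | h
    · exact key i j h
    · rfl
    · exact (key j i h).symm
end
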